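/- arXiv:2508.20192 — 2 statements merged into one kernel-verified Lean document; each statement's English description precedes it below -/
import Mathlib

section
/- Let q be a prime power, n ≥ 2, and let f ∈ 𝔽_q[x₁,…,xₙ] be a (not necessarily homogeneous) polynomial of total degree d ≥ 2 having no factor of degree 1 in 𝔽̄_q[x₁,…,xₙ]. Suppose (v₀,w₀) = (v₁,…,vₙ,w₂,…,wₙ) ∈ 𝔽_q^{2n−1} is such that f(X+v₁, w₂X+v₂, …, wₙX+vₙ) ∈ 𝔽_q[X] has degree d and has a simple root α₀ ∈ 𝔽̄_q. Then there are at most (3d−3)·q^{n−2} tuples z = (z₂,…,zₙ) ∈ 𝔽_q^{n−1} for which f_{v₀,w₀,z}(X,Y) has a factor of degree 1 in 𝔽̄_q[X,Y] vanishing at the point (α₀,0). -/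
open MvPolynomial

/-- The planar slice polynomial `f_{v,w,z}(X,Y)
  = f(X + v₁, w₂X + z₂Y + v₂, …, wₙX + zₙY + vₙ)`.
Here the variables of `f` are indexed by `Fin (n+1)` (so `f` has `n+1` variables,
corresponding to the paper's `n ≥ 2` variables with our `n ≥ 1`). -/
noncomputable def planarSlice {k : Type*} [CommSemiring k] {n : ℕ}
    (f : MvPolynomial (Fin (n + 1)) k) (v : Fin (n + 1) → k) (w z : Fin n → k) :
    MvPolynomial (Fin 2) k :=
  aeval (Fin.cases (X 0 + C (v 0))
    (fun j => C (w j) * X 0 + C (z j) * X 1 + C (v j.succ)) :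
      Fin (n + 1) → MvPolynomial (Fin 2) k) f

/-- The univariate restriction `f(X + v₁, w₂X + v₂, …, wₙX + vₙ) ∈ k[X]`,
i.e. the planar slice along the line `Y = 0`. -/
noncomputable def lineSlice {k : Type*} [CommSemiring k] {n : ℕ}
    (f : MvPolynomial (Fin (n + 1)) k) (v : Fin (n + 1) → k) (w : Fin n → k) :
    Polynomial k :=
  aeval (Fin.cases (Polynomial.X + Polynomial.C (v 0))
    (fun j => Polynomial.C (w j) * Polynomial.X + Polynomial.C (v j.succ)) :
      Fin (n + 1) → Polynomial k) f

/-- Chain rule for substituting univariate polynomials into a multivariate polynomial. -/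
theorem MvPolynomial.derivative_aeval {σ R : Type*} [Fintype σ] [CommRing R]
    (u : σ → Polynomial R) (p : MvPolynomial σ R) :
    Polynomial.derivative (aeval u p) =
      ∑ i, aeval u (pderiv i p) * Polynomial.derivative (u i) := by
  classical
  induction p using MvPolynomial.induction_on with
  | C a => simp
  | add p q hp hq => simp [hp, hq, add_mul, Finset.sum_add_distrib]
  | mul_X p i hp =>
    simp only [map_mul, aeval_X, Polynomial.derivative_mul, hp, Derivation.leibniz, pderiv_X,
      smul_eq_mul, map_add, add_mul, Finset.sum_add_distrib, Finset.sum_mul]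
    have h : ∑ j, aeval u p * aeval u ((Pi.single j 1 : σ → MvPolynomial σ R) i) *
        Polynomial.derivative (u j) = aeval u p * Polynomial.derivative (u i) := by
      rw [Finset.sum_eq_single i (fun j _ hj => ?_) (by simp)]
      · simp
      · simp [Pi.single_eq_of_ne hj.symm]
    rw [h, add_comm]
    exact congrArg _ (Finset.sum_congr rfl fun j _ => by ring)

/-- A polynomial in two variables of total degree at most one is affine linear. -/
theorem MvPolynomial.exists_eq_affine_of_totalDegree_le_one {R : Type*} [CommRing R]
    (g : MvPolynomial (Fin 2) R) (hg : g.totalDegree ≤ 1) :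
    ∃ a b c : R, g = C a + C b * X 0 + C c * X 1 := by
  classical
  refine ⟨coeff 0 g, coeff (Finsupp.single 0 1) g, coeff (Finsupp.single 1 1) g, ?_⟩
  ext m
  have h0 : (Finsupp.single (0 : Fin 2) 1 : Fin 2 →₀ ℕ) ≠ 0 := by simp
  have h1 : (Finsupp.single (1 : Fin 2) 1 : Fin 2 →₀ ℕ) ≠ 0 := by simp
  have h01 : (Finsupp.single (0 : Fin 2) 1 : Fin 2 →₀ ℕ) ≠ Finsupp.single 1 1 := by
    intro h
    simpa using DFunLike.congr_fun h 0
  simp only [coeff_add, coeff_C_mul, coeff_C, coeff_X]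
  by_cases hm : 1 < m.degree
  · rw [coeff_eq_zero_of_totalDegree_lt (lt_of_le_of_lt hg hm)]
    have e0 : 0 ≠ m := by rintro rfl; simp at hm
    have e1 : Finsupp.single 0 1 ≠ m := by rintro rfl; simp at hm
    have e2 : Finsupp.single 1 1 ≠ m := by rintro rfl; simp at hm
    simp [e0, e1, e2]
  · have hs : m 0 + m 1 ≤ 1 := by
      simpa [Finsupp.degree_eq_sum] using hm
    have : m = 0 ∨ m = Finsupp.single 0 1 ∨ m = Finsupp.single 1 1 := by
      have : (m 0 = 0 ∧ m 1 = 0) ∨ (m 0 = 1 ∧ m 1 = 0) ∨ (m 0 = 0 ∧ m 1 = 1) := by omega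
      refine this.imp (fun h => ?_) (Or.imp (fun h => ?_) fun h => ?_) <;>
      · ext i
        fin_cases i <;> simp [h.1, h.2]
    rcases this with rfl | rfl | rfl <;>
      simp [h0, h1, h0.symm, h1.symm, h01, h01.symm]

/-- If the images of the variables under an endomorphism are congruent to the variables modulo `l`,
then so is the image of every polynomial. -/
theorem MvPolynomial.dvd_sub_aeval {σ R : Type*} [CommRing R] (l : MvPolynomial σ R)
    (u : σ → MvPolynomial σ R) (hu : ∀ i, l ∣ X i - u i) (p : MvPolynomial σ R) :
    l ∣ p - aeval u p := by
  induction p using MvPolynomial.induction_on with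
  | C a => simp
  | add p q hp hq =>
    rw [map_add, add_sub_add_comm]
    exact dvd_add hp hq
  | mul_X p i hp =>
    have : p * X i - aeval u (p * X i) = (p - aeval u p) * X i + aeval u p * (X i - u i) := by
      rw [map_mul, aeval_X]; ring
    rw [this]
    exact dvd_add (hp.mul_right _) ((hu i).mul_left _)

theorem MvPolynomial.totalDegree_aeval_le {σ τ R : Type*} [CommRing R]
    (u : σ → MvPolynomial τ R) (hu : ∀ i, (u i).totalDegree ≤ 1) (p : MvPolynomial σ R) :
    (aeval u p).totalDegree ≤ p.totalDegree := by
  rw [aeval_def, eval₂_eq]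
  refine totalDegree_finsetSum_le fun m hm => ?_
  refine (totalDegree_mul _ _).trans ?_
  rw [algebraMap_eq, totalDegree_C, zero_add]
  refine (totalDegree_finsetProd _ _).trans ?_
  refine le_trans (Finset.sum_le_sum fun i _ => ?_) (le_totalDegree hm)
  refine (totalDegree_pow _ _).trans ?_
  simpa using Nat.mul_le_mul_left (m i) (hu i)

/-- The Schwartz-Zippel count of the zeros of a polynomial over an extension `K` of the finite field
`F` among the `F`-rational points. -/
theorem MvPolynomial.card_rational_zeros_le {F K : Type*} [Field F] [Fintype F] [Field K]
    [Algebra F K] {n : ℕ} (hn : 1 ≤ n) (p : MvPolynomial (Fin n) K) (hp : p ≠ 0) :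
    Nat.card {z : Fin n → F // eval (fun j => algebraMap F K (z j)) p = 0} ≤
      p.totalDegree * Fintype.card F ^ (n - 1) := by
  classical
  have hinj := (algebraMap F K).injective
  set S : Finset K := Finset.univ.image (algebraMap F K) with hS
  have hcard : S.card = Fintype.card F := by
    rw [hS, Finset.card_image_of_injective _ hinj, Finset.card_univ]
  have hsz := schwartz_zippel_totalDegree hp S
  rw [hcard] at hsz
  set Z := {x ∈ Fintype.piFinset fun _ : Fin n => S | eval x p = 0}
  have hle : Nat.card {z : Fin n → F // eval (fun j => algebraMap F K (z j)) p = 0} ≤ Z.card := by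
    rw [← Nat.card_eq_finsetCard Z]
    refine Nat.card_le_card_of_injective
      (fun z => ⟨fun j => algebraMap F K (z.1 j), by simp [Z, hS, z.2]⟩) ?_
    intro z z' h
    ext j
    exact hinj (congrFun (Subtype.ext_iff.1 h) j)
  refine hle.trans ?_
  have hq : (0 : ℚ≥0) < Fintype.card F := by exact_mod_cast Fintype.card_pos
  obtain ⟨m, rfl⟩ : ∃ m, n = m + 1 := ⟨n - 1, by omega⟩
  rw [div_le_div_iff₀ (by positivity) hq, pow_succ, ← mul_assoc] at hsz
  have := le_of_mul_le_mul_right hsz hq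
  exact_mod_cast this

/-- If a polynomial vanishes on the hyperplane that is the graph `x₀ - v₀ = α + ∑ cⱼ yⱼ` over
the sheared coordinates `yⱼ = xⱼ₊₁ - wⱼ (x₀ - v₀) - vⱼ₊₁`, then it has a factor of degree one. -/
theorem MvPolynomial.exists_dvd_totalDegree_eq_one {K : Type*} [Field K] {n : ℕ}
    (p : MvPolynomial (Fin (n + 1)) K) (v : Fin (n + 1) → K) (w c : Fin n → K) (α : K)
    (h : aeval (Fin.cases (C α + ∑ j, C (c j) * X j + C (v 0))
        (fun j => C (w j) * (C α + ∑ j, C (c j) * X j) + X j + C (v j.succ)) :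
          Fin (n + 1) → MvPolynomial (Fin n) K) p = 0) :
    ∃ g : MvPolynomial (Fin (n + 1)) K, g.totalDegree = 1 ∧ g ∣ p := by
  set y : Fin n → MvPolynomial (Fin (n + 1)) K :=
    fun j => X j.succ - C (w j) * (X 0 - C (v 0)) - C (v j.succ) with hy
  set l : MvPolynomial (Fin (n + 1)) K := X 0 - C (v 0) - C α - ∑ j, C (c j) * y j with hl
  have hX (i : Fin (n + 1)) : (X i : MvPolynomial (Fin (n + 1)) K).totalDegree ≤ 1 :=
    (totalDegree_X i).le
  have hC (a : K) : (C a : MvPolynomial (Fin (n + 1)) K).totalDegree ≤ 1 := by simp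
  have hCm (a : K) {r : MvPolynomial (Fin (n + 1)) K} (hr : r.totalDegree ≤ 1) :
      (C a * r).totalDegree ≤ 1 :=
    (totalDegree_mul _ _).trans (by simpa using hr)
  have hsub {r s : MvPolynomial (Fin (n + 1)) K} (hr : r.totalDegree ≤ 1)
      (hs : s.totalDegree ≤ 1) : (r - s).totalDegree ≤ 1 :=
    (totalDegree_sub _ _).trans (max_le hr hs)
  refine ⟨l, le_antisymm ?_ ?_, ?_⟩
  · refine hsub (hsub (hsub (hX _) (hC _)) (hC _)) (totalDegree_finsetSum_le fun j _ => ?_)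
    exact hCm _ (hsub (hsub (hX _) (hCm _ (hsub (hX _) (hC _)))) (hC _))
  · by_contra hlt
    obtain ⟨a, ha⟩ : ∃ a, l = C a := ⟨_, totalDegree_eq_zero_iff_eq_C.1 (by omega)⟩
    have key (t : K) :
        eval (Fin.cases (t + v 0) (fun j => w j * t + v j.succ) : Fin (n + 1) → K) l = t - α := by
      simp [hl, hy]
    have h0 := key 0
    have h1 := key 1
    rw [ha, eval_C] at h0 h1
    exact zero_ne_one (sub_left_injective (h0.symm.trans h1))
  · have hcomp := congrArg (aeval y) h
    rw [map_zero, comp_aeval_apply] at hcomp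
    rw [← sub_zero p, ← hcomp]
    refine dvd_sub_aeval l _ (fun i => ?_) p
    refine Fin.cases ?_ (fun j => ?_) i
    · refine ⟨1, ?_⟩
      simp [hl, algebraMap_eq]
      ring
    · refine ⟨C (w j), ?_⟩
      simp [hl, algebraMap_eq]
      rw [hy]
      ring

section AffineSubstitution

variable {F K : Type*} [Field F] [Field K] [Algebra F K] {n : ℕ}

theorem aeval_lineSlice {A : Type*} [CommRing A] [Algebra K A]
    (f : MvPolynomial (Fin (n + 1)) F) (v : Fin (n + 1) → F) (w : Fin n → F) (x : A) :
    Polynomial.aeval x ((lineSlice f v w).map (algebraMap F K)) =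
      aeval (Fin.cases (x + algebraMap K A (algebraMap F K (v 0)))
        (fun j => algebraMap K A (algebraMap F K (w j)) * x +
          algebraMap K A (algebraMap F K (v j.succ))) : Fin (n + 1) → A)
        (MvPolynomial.map (algebraMap F K) f) := by
  induction f using MvPolynomial.induction_on with
  | C a => simp [lineSlice]
  | add p q hp hq => simp_all [lineSlice]
  | mul_X p i hp =>
    simp only [lineSlice, map_mul, Polynomial.map_mul, aeval_X, map_X] at hp ⊢
    rw [hp]
    congr 1
    refine Fin.cases ?_ (fun j => ?_) i <;> simp

theorem aeval_planarSlice {A : Type*} [CommRing A] [Algebra K A]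
    (f : MvPolynomial (Fin (n + 1)) F) (v : Fin (n + 1) → F) (w z : Fin n → F) (x y : A) :
    aeval ![x, y] (MvPolynomial.map (algebraMap F K) (planarSlice f v w z)) =
      aeval (Fin.cases (x + algebraMap K A (algebraMap F K (v 0)))
        (fun j => algebraMap K A (algebraMap F K (w j)) * x +
          algebraMap K A (algebraMap F K (z j)) * y +
          algebraMap K A (algebraMap F K (v j.succ))) : Fin (n + 1) → A)
        (MvPolynomial.map (algebraMap F K) f) := by
  induction f using MvPolynomial.induction_on with
  | C a => simp [planarSlice]
  | add p q hp hq => simp_all [planarSlice]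
  | mul_X p i hp =>
    simp only [planarSlice, map_mul, aeval_X, map_X] at hp ⊢
    rw [hp]
    congr 1
    refine Fin.cases ?_ (fun j => ?_) i <;> simp

/-- The directions `z` for which the planar slice has a line through a simple root of the line slice
are rational zeros of a nonzero polynomial of degree at most `d`. -/
theorem card_slices_with_linear_factor_le [Fintype F] (hn : 1 ≤ n) {d : ℕ} (hd : d ≠ 0)
    (f : MvPolynomial (Fin (n + 1)) F) (hdeg : f.totalDegree = d)
    (hnolin : ¬ ∃ g : MvPolynomial (Fin (n + 1)) K,
      g.totalDegree = 1 ∧ g ∣ MvPolynomial.map (algebraMap F K) f)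
    (v : Fin (n + 1) → F) (w : Fin n → F)
    (hunideg : (lineSlice f v w).natDegree = d) (α₀ : K)
    (hsimple : Polynomial.aeval α₀ (Polynomial.derivative (lineSlice f v w)) ≠ 0) :
    Nat.card {z : Fin n → F //
        ∃ g : MvPolynomial (Fin 2) K, g.totalDegree = 1 ∧
          g ∣ MvPolynomial.map (algebraMap F K) (planarSlice f v w z) ∧
          MvPolynomial.eval ![α₀, 0] g = 0} ≤ d * Fintype.card F ^ (n - 1) := by
  set φ := algebraMap F K with hφ
  set p : MvPolynomial (Fin (n + 1)) K := MvPolynomial.map φ f with hp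
  set P : Fin (n + 1) → K :=
    Fin.cases (α₀ + φ (v 0)) (fun j => φ (w j) * α₀ + φ (v j.succ)) with hP
  set D : Fin (n + 1) → K := fun i => eval P (pderiv i p) with hD
  set s : K := D 0 + ∑ j : Fin n, D j.succ * φ (w j) with hs
  have hchain (a : K) (u : Fin (n + 1) → Polynomial K) (hu : ∀ i, (u i).eval a = P i) :
      (Polynomial.derivative (aeval u p)).eval a =
        ∑ i, D i * (Polynomial.derivative (u i)).eval a := by
    rw [derivative_aeval, Polynomial.eval_finsetSum]
    refine Finset.sum_congr rfl fun i _ => ?_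
    have h : (Polynomial.aeval a) (aeval u (pderiv i p)) = eval P (pderiv i p) := by
      rw [comp_aeval_apply, ← coe_aeval_eq_eval, RingHom.coe_coe]
      congr 2
      ext i
      simpa [Polynomial.aeval_def] using hu i
    rw [Polynomial.eval_mul, ← Polynomial.coe_aeval_eq_eval, h]
  have hline := aeval_lineSlice (K := K) f v w (Polynomial.X : Polynomial K)
  rw [Polynomial.aeval_X_left_apply] at hline
  have hs0 : s ≠ 0 := by
    have h := congrArg (fun r => (Polynomial.derivative r).eval α₀) hline
    rw [hchain α₀ _ (fun i => ?_), Polynomial.derivative_map, Polynomial.eval_map_algebraMap,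
      Fin.sum_univ_succ] at h
    · rw [h] at hsimple
      simpa [hs] using hsimple
    · refine Fin.cases ?_ (fun j => ?_) i <;> simp [hP, hφ]
  set c : Fin n → K := fun j => -D j.succ / s with hc
  set u : Fin (n + 1) → MvPolynomial (Fin n) K :=
    Fin.cases (C α₀ + ∑ j, C (c j) * X j + C (φ (v 0)))
      (fun j => C (φ (w j)) * (C α₀ + ∑ j, C (c j) * X j) + X j + C (φ (v j.succ))) with hu
  have hH : aeval u p ≠ 0 := fun h =>
    hnolin (exists_dvd_totalDegree_eq_one p (fun i => φ (v i)) (fun j => φ (w j)) c α₀ h)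
  have hHdeg : (aeval u p).totalDegree ≤ d := by
    refine (totalDegree_aeval_le u (fun i => ?_) p).trans ((Finset.sup_mono (support_map_subset _ _)).trans hdeg.le)
    have hC (a : K) : (C a : MvPolynomial (Fin n) K).totalDegree ≤ 1 := by simp
    have hCm (a : K) {r : MvPolynomial (Fin n) K} (hr : r.totalDegree ≤ 1) :
        (C a * r).totalDegree ≤ 1 :=
      (totalDegree_mul _ _).trans (by simpa using hr)
    have hadd {r t : MvPolynomial (Fin n) K} (hr : r.totalDegree ≤ 1)
        (ht : t.totalDegree ≤ 1) : (r + t).totalDegree ≤ 1 :=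
      (totalDegree_add _ _).trans (max_le hr ht)
    have hX (j : Fin n) : (X j : MvPolynomial (Fin n) K).totalDegree ≤ 1 := (totalDegree_X j).le
    have hL := hadd (hC α₀) (totalDegree_finsetSum_le fun j (_ : j ∈ Finset.univ) =>
      hCm (c j) (hX j))
    refine Fin.cases ?_ (fun j => ?_) i
    · exact hadd hL (hC _)
    · exact hadd (hadd (hCm _ hL) (hX j)) (hC _)
  have hbad (z : Fin n → F) (hz : ∃ g : MvPolynomial (Fin 2) K, g.totalDegree = 1 ∧
      g ∣ MvPolynomial.map φ (planarSlice f v w z) ∧ eval ![α₀, 0] g = 0) :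
      eval (fun j => φ (z j)) (aeval u p) = 0 := by
    obtain ⟨g, hg1, hgdvd, hg0⟩ := hz
    obtain ⟨a, b, e, rfl⟩ := exists_eq_affine_of_totalDegree_le_one g hg1.le
    simp only [map_add, map_mul, eval_C, eval_X, Matrix.cons_val_zero, Matrix.cons_val_one,
      mul_zero, add_zero] at hg0
    have hb : b ≠ 0 := by
      rintro rfl
      have ha : a = 0 := by simpa using hg0
      have h := map_dvd (aeval ![(Polynomial.X : Polynomial K), 0]) hgdvd
      rw [aeval_planarSlice] at h
      simp only [mul_zero, add_zero] at h
      rw [← hline] at h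
      have h0 : (lineSlice f v w).map φ = 0 := by simpa [ha] using h
      rw [Polynomial.map_eq_zero] at h0
      rw [h0, Polynomial.natDegree_zero] at hunideg
      exact hd hunideg.symm
    set β := -e / b with hβ
    have hpath := map_dvd (aeval ![Polynomial.C α₀ + Polynomial.C β * Polynomial.X,
      (Polynomial.X : Polynomial K)]) hgdvd
    have hg : aeval ![Polynomial.C α₀ + Polynomial.C β * Polynomial.X,
        (Polynomial.X : Polynomial K)] (C a + C b * X 0 + C e * X 1) = 0 := by
      have ha : a = -(b * α₀) := by linear_combination hg0
      have he : e = -(b * β) := by rw [hβ, mul_div_cancel₀ _ hb, neg_neg]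
      simp only [map_add, map_mul, aeval_X, aeval_C, Matrix.cons_val_zero, Matrix.cons_val_one,
        Polynomial.algebraMap_eq]
      rw [ha, he]
      simp only [map_neg, map_mul]
      ring
    rw [hg, zero_dvd_iff, aeval_planarSlice] at hpath
    have hder := congrArg (fun r => (Polynomial.derivative r).eval 0) hpath
    rw [hchain 0 _ (fun i => ?_), Fin.sum_univ_succ] at hder
    · have hder' : 0 = D 0 * β + ∑ j : Fin n, D j.succ * (φ (w j) * β + φ (z j)) := by
        simpa using hder.symm
      have hβL : ∑ j, c j * φ (z j) = β := by
        have h1 : s * β = - ∑ j : Fin n, D j.succ * φ (z j) := by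
          simp only [mul_add, Finset.sum_add_distrib, ← mul_assoc, ← Finset.sum_mul] at hder'
          rw [hs]
          linear_combination -hder'
        apply mul_left_cancel₀ hs0
        rw [h1, Finset.mul_sum, ← Finset.sum_neg_distrib]
        refine Finset.sum_congr rfl fun j _ => ?_
        rw [hc]
        field_simp
      have h1 := congrArg (Polynomial.aeval (1 : K)) hpath
      rw [map_zero, comp_aeval_apply] at h1
      rw [← coe_aeval_eq_eval, RingHom.coe_coe, comp_aeval_apply, ← h1]
      congr 2
      ext i
      rw [hφ] at hβL
      refine Fin.cases ?_ (fun j => ?_) i <;> simp [hu, hβL, hφ]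
    · refine Fin.cases ?_ (fun j => ?_) i <;> simp [hP, hφ]
  calc _ ≤ Nat.card {z : Fin n → F // eval (fun j => φ (z j)) (aeval u p) = 0} :=
        Nat.card_le_card_of_injective _ (Subtype.map_injective hbad Function.injective_id)
    _ ≤ (aeval u p).totalDegree * Fintype.card F ^ (n - 1) := card_rational_zeros_le hn _ hH
    _ ≤ d * Fintype.card F ^ (n - 1) := Nat.mul_le_mul_right _ hHdeg

end AffineSubstitution

/-- **Corollary 2.5 / Theorem B (exceptional-set form).**
Over `𝔽_q`, with `f` of total degree `d ≥ 2`, no degree-one factor over the algebraic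
closure, and `(v₀, w₀)` such that `f(X+v₁, w₂X+v₂, …, wₙX+vₙ)` has degree `d` and a
simple root `α₀` in the algebraic closure, there are at most `(3d-3) q^{(n+1)-2}`
tuples `z ∈ 𝔽_q^{n}` for which `f_{v₀,w₀,z}` has a degree-one factor over the
algebraic closure vanishing at `(α₀, 0)`. -/
theorem stmt4 (q n d : ℕ) (hn : 1 ≤ n) (hd : 2 ≤ d)
    (F : Type*) [Field F] [Fintype F] (hq : Fintype.card F = q)
    (f : MvPolynomial (Fin (n + 1)) F)
    (hdeg : f.totalDegree = d)
    (hnolin : ¬ ∃ g : MvPolynomial (Fin (n + 1)) (AlgebraicClosure F),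
      g.totalDegree = 1 ∧ g ∣ MvPolynomial.map (algebraMap F (AlgebraicClosure F)) f)
    (v : Fin (n + 1) → F) (w : Fin n → F)
    (hunideg : (lineSlice f v w).natDegree = d)
    (α₀ : AlgebraicClosure F)
    (hroot : Polynomial.aeval α₀ (lineSlice f v w) = 0)
    (hsimple : Polynomial.aeval α₀ (Polynomial.derivative (lineSlice f v w)) ≠ 0) :
    Nat.card {z : Fin n → F //
        ∃ g : MvPolynomial (Fin 2) (AlgebraicClosure F),
          g.totalDegree = 1 ∧
          g ∣ MvPolynomial.map (algebraMap F (AlgebraicClosure F))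
              (planarSlice f v w z) ∧
          MvPolynomial.eval ![α₀, 0] g = 0} ≤ (3 * d - 3) * q ^ (n - 1) := by
  subst hq
  exact (card_slices_with_linear_factor_le hn (by omega) f hdeg hnolin v w hunideg α₀ hsimple).trans
    (Nat.mul_le_mul_right _ (by omega))
end

section
/- Let q be a prime power with q > 7, let m ≥ 2, and let f ∈ 𝔽_q[x₀,…,x_m] be a nonzero homogeneous polynomial of degree 7 with hypersurface X_f ⊂ P^m. Let U be a linear subvariety of P^m of dimension at least 1, defined over 𝔽_q and contained in X_f, and let v be an 𝔽_q-point of X_f not lying on U. If there exist three distinct linear subvarieties U₁, U₂, U₃ ⊆ U of codimension 1 in U, each defined over 𝔽_q, such that ⟨Uᵢ, v⟩ ⊆ X_f for i = 1, 2, 3, then either X_f has a smooth 𝔽_q-point or ⟨U, v⟩ ⊆ X_f. -/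
/-- Given finitely many linear forms, none vanishing at both `x` and `y`, some point `y + c • x`
of the line through `y` in direction `x` avoids all their kernels when the field is large. -/
lemma exists_forall_apply_add_smul_ne_zero {K V κ : Type*} [Field K] [Fintype K] [AddCommGroup V]
    [Module K V] (s : Finset κ) (φ : κ → Module.Dual K V) (hs : s.card < Fintype.card K) (x y : V)
    (h : ∀ i ∈ s, φ i x ≠ 0 ∨ φ i y ≠ 0) : ∃ c : K, ∀ i ∈ s, φ i (y + c • x) ≠ 0 := by
  classical
  obtain ⟨c, hc⟩ : ∃ c, c ∉ s.image fun i => -φ i y / φ i x := by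
    by_contra! hall
    have := Finset.card_image_le (s := s) (f := fun i => -φ i y / φ i x)
    rw [Finset.eq_univ_of_forall hall, Finset.card_univ] at this
    omega
  refine ⟨c, fun i hi h0 => ?_⟩
  simp only [map_add, map_smul, smul_eq_mul] at h0
  by_cases hx : φ i x = 0
  · exact (h i hi).elim (· hx) fun hy => hy (by simpa [hx] using h0)
  · refine hc (Finset.mem_image.2 ⟨i, hi, ?_⟩)
    rw [div_eq_iff hx]
    linear_combination -h0

/-- Fewer than `#K` proper hyperplane sections do not cover a vector space over `K`. -/
lemma exists_mem_forall_dual_apply_ne_zero {K V κ : Type*} [Field K] [Fintype K] [AddCommGroup V]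
    [Module K V] (W : Submodule K V) (s : Finset κ) (φ : κ → Module.Dual K V)
    (hs : s.card < Fintype.card K) (h : ∀ i ∈ s, ∃ x ∈ W, φ i x ≠ 0) :
    ∃ x ∈ W, ∀ i ∈ s, φ i x ≠ 0 := by
  classical
  induction s using Finset.induction_on with
  | empty => exact ⟨0, W.zero_mem, by simp⟩
  | insert a s ha ih =>
    rw [Finset.card_insert_of_notMem ha] at hs
    obtain ⟨x, hxW, hx⟩ := ih (by omega) fun i hi => h i (Finset.mem_insert_of_mem hi)
    obtain ⟨y, hyW, hy⟩ := h a (Finset.mem_insert_self a s)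
    obtain ⟨c, hc⟩ := exists_forall_apply_add_smul_ne_zero (insert a s) φ
      (by rwa [Finset.card_insert_of_notMem ha]) x y fun i hi => by
        rcases Finset.mem_insert.1 hi with rfl | hi
        exacts [Or.inr hy, Or.inl (hx i hi)]
    exact ⟨_, W.add_mem hyW (W.smul_mem c hxW), hc⟩

/-- A subspace covered by `W` is cut out in `W` by a linear form. -/
lemma CovBy.exists_dual_forall_mem_iff {K V : Type*} [Field K] [AddCommGroup V] [Module K V]
    {H W : Submodule K V} (h : H ⋖ W) : ∃ φ : Module.Dual K V, ∀ x ∈ W, φ x = 0 ↔ x ∈ H := by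
  obtain ⟨y, hyW, hyH⟩ := SetLike.exists_of_lt h.lt
  obtain ⟨φ, hφy, hφ⟩ := Submodule.exists_le_ker_of_notMem hyH
  refine ⟨φ, fun x hx => ⟨fun h0 => ?_, fun hxH => hφ hxH⟩⟩
  have hlt : W ⊓ LinearMap.ker φ < W := inf_le_left.lt_of_ne fun he =>
    hφy (inf_eq_left.1 he hyW)
  rw [← (h.eq_or_eq (le_inf h.le hφ) hlt.le).resolve_right hlt.ne]
  exact ⟨hx, h0⟩

lemma Submodule.covBy_of_finrank_add_one_eq {K V : Type*} [Field K] [AddCommGroup V] [Module K V]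
    [FiniteDimensional K V] {H W : Submodule K V} (hle : H ≤ W)
    (h : Module.finrank K H + 1 = Module.finrank K W) : H ⋖ W := by
  refine ⟨hle.lt_of_ne fun he => ?_, fun N h₁ h₂ => ?_⟩
  · rw [he] at h
    omega
  · have := Submodule.finrank_lt_finrank_of_lt h₁
    have := Submodule.finrank_lt_finrank_of_lt h₂
    omega

/-- The restriction of a multivariate polynomial to the line `w + X d`. -/
noncomputable def MvPolynomial.restrictLine {σ R : Type*} [CommRing R] (w d : σ → R) :
    MvPolynomial σ R →ₐ[R] Polynomial R :=
  MvPolynomial.aeval fun k => Polynomial.C (w k) + Polynomial.C (d k) * Polynomial.X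

lemma MvPolynomial.eval_restrictLine {σ R : Type*} [CommRing R] (w d : σ → R)
    (f : MvPolynomial σ R) (r : R) :
    (restrictLine w d f).eval r = MvPolynomial.eval (w + r • d) f := by
  induction f using MvPolynomial.induction_on with
  | C a => simp [restrictLine]
  | add p q hp hq => simp [hp, hq]
  | mul_X p i hp =>
    rw [map_mul, Polynomial.eval_mul, hp]
    simp [restrictLine, mul_comm r]

lemma MvPolynomial.eval_derivative_restrictLine {σ R : Type*} [Fintype σ] [CommRing R]
    (w d : σ → R) (f : MvPolynomial σ R) (r : R) :
    (Polynomial.derivative (restrictLine w d f)).eval r =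
      ∑ i, d i * MvPolynomial.eval (w + r • d) (MvPolynomial.pderiv i f) := by
  classical
  induction f using MvPolynomial.induction_on with
  | C a => simp [restrictLine]
  | add p q hp hq => simp [hp, hq, mul_add, Finset.sum_add_distrib]
  | mul_X p j hp =>
    have hX : Polynomial.derivative (restrictLine w d (X j)) = Polynomial.C (d j) := by
      simp [restrictLine]
    rw [map_mul, Polynomial.derivative_mul, Polynomial.eval_add, Polynomial.eval_mul,
      Polynomial.eval_mul, hp, hX, eval_restrictLine, eval_restrictLine, Polynomial.eval_C]
    simp only [Derivation.leibniz, pderiv_X, smul_eq_mul, map_add, map_mul, mul_add,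
      Finset.sum_add_distrib, Finset.sum_mul, eval_X]
    rw [Finset.sum_eq_single (f := fun i => d i * (eval (w + r • d) p * _)) j
      (fun i _ hi => by simp [Pi.single_eq_of_ne hi.symm]) (by simp), Pi.single_eq_same, map_one,
      mul_one, add_comm, mul_comm (d j)]
    congr 1
    exact Finset.sum_congr rfl fun i _ => by ring

/-- If `p` has degree less than `2 n` and `n` distinct double roots, then `p = 0`. -/
lemma Polynomial.eq_zero_of_forall_double_root {K ι : Type*} [Field K] [Fintype ι]
    (p : Polynomial K) (r : ι → K) (hr : Function.Injective r)
    (hdeg : p.natDegree < 2 * Fintype.card ι) (h₀ : ∀ i, p.eval (r i) = 0)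
    (h₁ : ∀ i, (derivative p).eval (r i) = 0) : p = 0 := by
  by_contra hp
  have hdvd : ∏ i, (X - C (r i)) ^ 2 ∣ p :=
    Fintype.prod_dvd_of_coprime
      (fun i j hij => (Polynomial.pairwise_coprime_X_sub_C hr hij).pow)
      fun i => (le_rootMultiplicity_iff hp).1
        ((one_lt_rootMultiplicity_iff_isRoot hp).2 ⟨h₀ i, h₁ i⟩)
  refine hp (eq_zero_of_dvd_of_natDegree_lt hdvd ?_)
  rw [natDegree_prod _ _ fun i _ => pow_ne_zero 2 (X_sub_C_ne_zero _)]
  simpa [mul_comm] using hdeg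

/-- Suppose all rational zeros of `f` are singular. If `f` vanishes on pairwise distinct hyperplanes
`H i` of `W`, more than half as many as the degree of `f`, then `f` vanishes on `W`. -/
lemma MvPolynomial.eval_eq_zero_of_covBy {σ K ι : Type*} [Fintype σ] [Field K] [Fintype K]
    [Fintype ι] [LinearOrder ι] (f : MvPolynomial σ K)
    (hsing : ∀ a, eval a f = 0 → ∀ i, eval a (pderiv i f) = 0)
    (W : Submodule K (σ → K)) (H : ι → Submodule K (σ → K)) (hH : Function.Injective H)
    (hcov : ∀ i, H i ⋖ W) (hvan : ∀ i, ∀ x ∈ H i, eval x f = 0)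
    (hdeg : f.totalDegree < 2 * Fintype.card ι) (hcard : Fintype.card ι < Fintype.card K)
    (hpairs : Fintype.card {p : ι × ι // p.1 < p.2} < Fintype.card K) :
    ∀ w ∈ W, eval w f = 0 := by
  intro w hw
  by_cases hwH : ∃ i, w ∈ H i
  · exact hwH.elim fun i hi => hvan i w hi
  push Not at hwH
  choose φ hφ using fun i => (hcov i).exists_dual_forall_mem_iff
  have hφw : ∀ i, φ i w ≠ 0 := fun i h0 => hwH i ((hφ i w hw).1 h0)
  obtain ⟨y, hyW, hy⟩ := exists_mem_forall_dual_apply_ne_zero W Finset.univ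
    (fun p : {p : ι × ι // p.1 < p.2} => φ p.1.1 w • φ p.1.2 - φ p.1.2 w • φ p.1.1) hpairs
    (by
      rintro ⟨⟨i, j⟩, hij⟩ -
      by_contra! hzero
      have hle : H i ≤ H j := fun x hx => by
        have hxW := (hcov i).le hx
        have h0 := hzero x hxW
        rw [LinearMap.sub_apply, LinearMap.smul_apply, LinearMap.smul_apply,
          (hφ i x hxW).2 hx, smul_zero, sub_zero, smul_eq_mul] at h0
        exact (hφ j x hxW).1 ((mul_eq_zero.1 h0).resolve_left (hφw i))
      exact hij.ne' (hH (((hcov i).eq_or_eq hle (hcov j).le).resolve_right (hcov j).ne)))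
  obtain ⟨c, hc⟩ := exists_forall_apply_add_smul_ne_zero Finset.univ φ hcard w y
    fun i _ => Or.inl (hφw i)
  set d := y + c • w with hd
  have hdW : d ∈ W := W.add_mem hyW (W.smul_mem c hw)
  have hφd : ∀ i, φ i d ≠ 0 := fun i => hc i (Finset.mem_univ i)
  have hcross : ∀ i j, i < j → φ i w * φ j d ≠ φ j w * φ i d := fun i j hij he => by
    refine hy ⟨(i, j), hij⟩ (Finset.mem_univ _) ?_
    simp only [hd, map_add, map_smul, smul_eq_mul] at he
    simp only [LinearMap.sub_apply, LinearMap.smul_apply, smul_eq_mul]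
    linear_combination he
  have hinj : Function.Injective fun i => -φ i w / φ i d := by
    intro i j hij
    have he : φ i w * φ j d = φ j w * φ i d := by
      have := (div_eq_div_iff (hφd i) (hφd j)).1 hij
      linear_combination -this
    rcases lt_trichotomy i j with h | h | h
    · exact absurd he (hcross i j h)
    · exact h
    · exact absurd he.symm (hcross j i h)
  have hroot : ∀ i, eval (w + (-φ i w / φ i d) • d) f = 0 := fun i => by
    refine hvan i _ ((hφ i _ (W.add_mem hw (W.smul_mem _ hdW))).1 ?_)
    simp [div_mul_cancel₀ _ (hφd i)]
  have hzero : restrictLine w d f = 0 := by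
    refine Polynomial.eq_zero_of_forall_double_root _ _ hinj ?_ (fun i => ?_) fun i => ?_
    · refine lt_of_le_of_lt ?_ hdeg
      simpa [restrictLine] using aeval_natDegree_le f le_rfl
        (fun k => Polynomial.C (w k) + Polynomial.C (d k) * Polynomial.X) (n := 1) fun k => by
          rw [add_comm]
          exact Polynomial.natDegree_linear_le
    · rw [eval_restrictLine, hroot]
    · rw [eval_derivative_restrictLine]
      exact Finset.sum_eq_zero fun k _ => by rw [hsing _ (hroot i), mul_zero]
  simpa [hzero] using (eval_restrictLine w d f 0).symm

/-- **Lemma 3.5.** Let `q > 7`, `m ≥ 2`, and `f` a nonzero degree-7 form in `m + 1`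
variables over `𝔽_q` with hypersurface `X_f`. Let `U` be a linear subvariety of
`P^m` of projective dimension at least 1 (i.e. a subspace of `𝔽_q^{m+1}` of
dimension at least 2) contained in `X_f`, and `v` an `𝔽_q`-point of `X_f` not on
`U`. If there are three distinct codimension-1 linear subvarieties `U₁, U₂, U₃`
of `U`, each of whose span with `v` is contained in `X_f`, then either `X_f` has a
smooth `𝔽_q`-point or `⟨U, v⟩ ⊆ X_f`. -/
theorem stmt12 (q m : ℕ) (hq7 : 7 < q) (hm : 2 ≤ m)
    (F : Type*) [Field F] [Fintype F] (hq : Fintype.card F = q)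
    (f : MvPolynomial (Fin (m + 1)) F) (hf0 : f ≠ 0) (hf : f.IsHomogeneous 7)
    (U : Submodule F (Fin (m + 1) → F)) (hUdim : 2 ≤ Module.finrank F U)
    (hUf : ∀ x ∈ U, MvPolynomial.eval x f = 0)
    (v : Fin (m + 1) → F) (hv0 : v ≠ 0) (hvf : MvPolynomial.eval v f = 0)
    (hvU : v ∉ U)
    (U₁ U₂ U₃ : Submodule F (Fin (m + 1) → F))
    (hsub₁ : U₁ ≤ U) (hsub₂ : U₂ ≤ U) (hsub₃ : U₃ ≤ U)
    (hne₁₂ : U₁ ≠ U₂) (hne₁₃ : U₁ ≠ U₃) (hne₂₃ : U₂ ≠ U₃)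
    (hcodim₁ : Module.finrank F U₁ + 1 = Module.finrank F U)
    (hcodim₂ : Module.finrank F U₂ + 1 = Module.finrank F U)
    (hcodim₃ : Module.finrank F U₃ + 1 = Module.finrank F U)
    (hspan₁ : ∀ x ∈ U₁ ⊔ Submodule.span F {v}, MvPolynomial.eval x f = 0)
    (hspan₂ : ∀ x ∈ U₂ ⊔ Submodule.span F {v}, MvPolynomial.eval x f = 0)
    (hspan₃ : ∀ x ∈ U₃ ⊔ Submodule.span F {v}, MvPolynomial.eval x f = 0) :
    (∃ a : Fin (m + 1) → F, a ≠ 0 ∧ MvPolynomial.eval a f = 0 ∧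
        ∃ i, MvPolynomial.eval a (MvPolynomial.pderiv i f) ≠ 0) ∨
    (∀ x ∈ U ⊔ Submodule.span F {v}, MvPolynomial.eval x f = 0) := by
  refine or_iff_not_imp_left.2 fun hns => ?_
  push Not at hns
  have hsing : ∀ a, MvPolynomial.eval a f = 0 →
      ∀ i, MvPolynomial.eval a (MvPolynomial.pderiv i f) = 0 := by
    intro a ha i
    by_cases ha0 : a = 0
    · rw [ha0, MvPolynomial.eval_zero, MvPolynomial.constantCoeff_eq]
      exact hf.pderiv.coeff_eq_zero (by simp)
    · exact hns a ha0 ha i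
  have hdisj : Submodule.span F {v} ⊓ U = ⊥ :=
    (((Submodule.disjoint_span_singleton' hv0).2 hvU).symm).eq_bot
  have hinter : ∀ N ≤ U, (N ⊔ Submodule.span F {v}) ⊓ U = N := fun N hN => by
    rw [sup_inf_assoc_of_le _ hN, hdisj, sup_bot_eq]
  have hfin : ∀ N ≤ U, Module.finrank F ↥(N ⊔ Submodule.span F {v}) = Module.finrank F N + 1 :=
    fun N hN => by
      have h := Submodule.finrank_sup_add_finrank_inf_eq N (Submodule.span F {v})
      have hbot : N ⊓ Submodule.span F {v} = ⊥ :=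
        eq_bot_mono (inf_comm N _ ▸ inf_le_inf_left _ hN) hdisj
      rwa [hbot, finrank_bot, add_zero, finrank_span_singleton hv0] at h
  have hvmem : ∀ N : Submodule F (Fin (m + 1) → F), v ∈ N ⊔ Submodule.span F {v} := fun N =>
    Submodule.mem_sup_right (Submodule.mem_span_singleton_self v)
  have hneU : ∀ N : Submodule F (Fin (m + 1) → F), U ≠ N ⊔ Submodule.span F {v} := fun N h =>
    hvU (h ▸ hvmem N)
  have hsup : ∀ N ≤ U, ∀ N' ≤ U, N ≠ N' →
      N ⊔ Submodule.span F {v} ≠ N' ⊔ Submodule.span F {v} := fun N hN N' hN' hne h =>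
    hne (by rw [← hinter N hN, h, hinter N' hN'])
  have hcov : ∀ N ≤ U, Module.finrank F N + 1 = Module.finrank F U →
      N ⊔ Submodule.span F {v} ⋖ U ⊔ Submodule.span F {v} := fun N hN h =>
    Submodule.covBy_of_finrank_add_one_eq (sup_le_sup_right hN _) (by
      rw [hfin N hN, hfin U le_rfl, h])
  refine MvPolynomial.eval_eq_zero_of_covBy f hsing (U ⊔ Submodule.span F {v})
    ![U, U₁ ⊔ Submodule.span F {v}, U₂ ⊔ Submodule.span F {v}, U₃ ⊔ Submodule.span F {v}]
    ?_ ?_ ?_ ?_ ?_ ?_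
  · have h₁₂ := hsup U₁ hsub₁ U₂ hsub₂ hne₁₂
    have h₁₃ := hsup U₁ hsub₁ U₃ hsub₃ hne₁₃
    have h₂₃ := hsup U₂ hsub₂ U₃ hsub₃ hne₂₃
    intro i j hij
    fin_cases i <;> fin_cases j <;>
      first
      | rfl
      | exact absurd hij (hneU _)
      | exact absurd hij.symm (hneU _)
      | exact absurd hij ‹_›
      | exact absurd hij.symm ‹_›
  · intro i
    fin_cases i
    · exact Submodule.covBy_of_finrank_add_one_eq le_sup_left (hfin U le_rfl).symm
    · exact hcov U₁ hsub₁ hcodim₁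
    · exact hcov U₂ hsub₂ hcodim₂
    · exact hcov U₃ hsub₃ hcodim₃
  · intro i
    fin_cases i
    exacts [hUf, hspan₁, hspan₂, hspan₃]
  · have := hf.totalDegree_le
    simp only [Fintype.card_fin]
    omega
  · simp only [Fintype.card_fin]
    omega
  · have : Fintype.card {p : Fin 4 × Fin 4 // p.1 < p.2} = 6 := by decide
    rw [Fintype.card_congr (Equiv.refl _), this]
    omega
end
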